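/- Work over K = ℂ and let L ⊆ Sym^3 be the ℂ-span of {s²·t, s·t², s³ + t³}. Then for every Q = (α, β) ∈ ℂ × ℂ with (α, β) ≠ (0, 0): the value semigroup S(L, Q) is finitely generated if and only if α ≠ 0 and β/α is a root of unity (i.e. there exists n > 0 with (β/α)ⁿ = 1); equivalently, if and only if there exists k > 0 with β^{3k} = (−α)^{3k}. In particular S(L, Q) fails to be finitely generated for some Q, yet there are infinitely many Q for which it is finitely generated. (Example 4.13 of the paper.) -/

import Mathlib

open MvPolynomial Filter

noncomputable section

variable {K : Type} [Field K]

/-- The linear form `β·s − α·t` in `K[s,t]`, cutting out the point `Q = (α : β)` of `ℙ¹`. -/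
def lform (α β : K) : MvPolynomial (Fin 2) K := C β * X 0 - C α * X 1

/-- The value semigroup `S(L, Q) = {(k, ord_Q f) : f ∈ L^k, f ≠ 0}` of the homogeneous
valuation `ν_Q` on `R(L) = ⨁ₖ L^k`, where `ord_Q f` is the largest `e` such that
`(β·s − α·t)^e` divides `f`. -/
def curveValueSemigroup (L : Submodule K (MvPolynomial (Fin 2) K)) (α β : K) :
    AddSubmonoid (ℤ × ℤ) :=
  AddSubmonoid.closure
    {p | ∃ (k e : ℕ) (f : MvPolynomial (Fin 2) K), f ∈ L ^ k ∧ f ≠ 0 ∧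
      (lform α β) ^ e ∣ f ∧ ¬ (lform α β) ^ (e + 1) ∣ f ∧ p = ((k : ℤ), (e : ℤ))}

/-- The linear system spanned by `s²·t, s·t², s³ + t³`, which embeds `ℙ¹` as a nodal cubic with
the points `(1 : 0)` and `(0 : 1)` glued. -/
abbrev nodalCubicSystem : Submodule ℂ (MvPolynomial (Fin 2) ℂ) :=
  Submodule.span ℂ
    ({X 0 ^ 2 * X 1, X 0 * X 1 ^ 2, X 0 ^ 3 + X 1 ^ 3} : Set (MvPolynomial (Fin 2) ℂ))

section LinearForm

lemma isHomogeneous_lform (α β : K) : (lform α β).IsHomogeneous 1 :=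
  (isHomogeneous_C_mul_X β 0).sub (isHomogeneous_C_mul_X α 1)

lemma eval_lform (α β x y : K) : eval ![x, y] (lform α β) = β * x - α * y := by
  simp [lform]

lemma lform_ne_zero {α β : K} (h : (α, β) ≠ ((0 : K), (0 : K))) : lform α β ≠ 0 := by
  intro h0
  have h1 := eval_lform α β 1 0
  have h2 := eval_lform α β 0 1
  simp only [h0, map_zero] at h1 h2
  exact h (Prod.ext (by simpa using h2.symm) (by simpa using h1.symm))

lemma not_lform_pow_succ_dvd {α β : K} (h : (α, β) ≠ ((0 : K), (0 : K)))
    {g : MvPolynomial (Fin 2) K} (hg : eval ![α, β] g ≠ 0) (e : ℕ) :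
    ¬ lform α β ^ (e + 1) ∣ lform α β ^ e * g := by
  rw [pow_succ, mul_dvd_mul_iff_left (pow_ne_zero _ (lform_ne_zero h))]
  rintro ⟨q, rfl⟩
  exact hg (by rw [map_mul, eval_lform, mul_comm β α, sub_self, zero_mul])

/-- A cofactor of a nonzero homogeneous polynomial in a homogeneous polynomial is homogeneous. -/
lemma isHomogeneous_of_mul_left {σ : Type*} {p q : MvPolynomial σ K} {a b : ℕ}
    (hp : p.IsHomogeneous a) (hp0 : p ≠ 0) (h : (p * q).IsHomogeneous (a + b)) :
    q.IsHomogeneous b := by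
  let _ := gradedAlgebra (σ := σ) (R := K)
  have h1 := DirectSum.coe_decompose_mul_add_of_left_mem (homogeneousSubmodule σ K) (i := a)
    (j := b) (a := p) (b := q) hp
  rw [DirectSum.decompose_of_mem_same _ h] at h1
  rw [mul_left_cancel₀ hp0 h1]
  exact (DirectSum.decompose (homogeneousSubmodule σ K) q b).2

lemma le_of_lform_pow_dvd {α β : K} (h : (α, β) ≠ ((0 : K), (0 : K)))
    {f : MvPolynomial (Fin 2) K} {n e : ℕ} (hf : f.IsHomogeneous n) (hf0 : f ≠ 0)
    (hd : lform α β ^ e ∣ f) : e ≤ n := by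
  obtain ⟨g, rfl⟩ := hd
  have hl : lform α β ^ e ≠ 0 := pow_ne_zero _ (lform_ne_zero h)
  have h1 := totalDegree_mul_of_isDomain hl (right_ne_zero_of_mul hf0)
  rw [hf.totalDegree hf0, ((isHomogeneous_lform α β).pow e).totalDegree hl] at h1
  omega

end LinearForm

section Powers

lemma isHomogeneous_of_mem_pow {k : ℕ} {f : MvPolynomial (Fin 2) ℂ}
    (hf : f ∈ nodalCubicSystem ^ k) : f.IsHomogeneous (3 * k) := by
  have hL : nodalCubicSystem ≤ homogeneousSubmodule (Fin 2) ℂ 3 := by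
    refine Submodule.span_le.2 ?_
    rintro _ (rfl | rfl | rfl)
    · exact (isHomogeneous_X_pow 0 2).mul (isHomogeneous_X ℂ 1)
    · exact (isHomogeneous_X ℂ 0).mul (isHomogeneous_X_pow 1 2)
    · exact (isHomogeneous_X_pow 0 3).add (isHomogeneous_X_pow 1 3)
  induction k generalizing f with
  | zero =>
    obtain ⟨c, rfl⟩ := Submodule.mem_one.1 (pow_zero nodalCubicSystem ▸ hf)
    exact isHomogeneous_C _ c
  | succ k ih =>
    rw [pow_succ] at hf
    induction hf using Submodule.mul_induction_on' with
    | mem_mul_mem m hm n hn => exact (ih hm).mul (hL hn)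
    | add x _ y _ hx hy => exact hx.add hy

lemma eval_eq_of_mem_pow {k : ℕ} {f : MvPolynomial (Fin 2) ℂ}
    (hf : f ∈ nodalCubicSystem ^ k) : eval ![1, 0] f = eval ![0, 1] f := by
  have hL : ∀ g ∈ nodalCubicSystem, eval ![1, 0] g = eval ![0, 1] g := by
    intro g hg
    induction hg using Submodule.span_induction with
    | mem x hx => rcases hx with rfl | rfl | rfl <;> simp
    | zero => simp
    | add x y _ _ hx hy => rw [map_add, map_add, hx, hy]
    | smul a x _ hx => rw [smul_eval, smul_eval, hx]
  induction k generalizing f with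
  | zero =>
    obtain ⟨c, rfl⟩ := Submodule.mem_one.1 (pow_zero nodalCubicSystem ▸ hf)
    simp [algebraMap_eq]
  | succ k ih =>
    rw [pow_succ] at hf
    induction hf using Submodule.mul_induction_on' with
    | mem_mul_mem m hm n hn => rw [map_mul, map_mul, ih hm, hL n hn]
    | add x _ y _ hx hy => rw [map_add, map_add, hx, hy]

lemma X_pow_mul_X_pow_mem_pow {k i j : ℕ} (h : i + 1 + (j + 1) = 3 * k) :
    (X 0 ^ (i + 1) * X 1 ^ (j + 1) : MvPolynomial (Fin 2) ℂ) ∈ nodalCubicSystem ^ k := by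
  have h1 : (X 0 ^ 2 * X 1 : MvPolynomial (Fin 2) ℂ) ∈ nodalCubicSystem :=
    Submodule.subset_span (by simp)
  have h2 : (X 0 * X 1 ^ 2 : MvPolynomial (Fin 2) ℂ) ∈ nodalCubicSystem :=
    Submodule.subset_span (by simp)
  have h3 : (X 0 ^ 3 + X 1 ^ 3 : MvPolynomial (Fin 2) ℂ) ∈ nodalCubicSystem :=
    Submodule.subset_span (by simp)
  induction k generalizing i j with
  | zero => omega
  | succ k ih =>
    rcases Nat.eq_zero_or_pos k with rfl | hk
    · obtain ⟨rfl, rfl⟩ | ⟨rfl, rfl⟩ : i = 1 ∧ j = 0 ∨ i = 0 ∧ j = 1 := by omega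
      · simpa using h1
      · simpa using h2
    have hA : ∀ a b : ℕ, a + 1 + (b + 1) = 3 * k →
        (X 0 ^ (a + 3) * X 1 ^ (b + 2) : MvPolynomial (Fin 2) ℂ) ∈
          nodalCubicSystem ^ (k + 1) := by
      intro a b hab
      rw [pow_succ]
      convert Submodule.mul_mem_mul (ih hab) h1 using 1
      ring
    have hB : ∀ a b : ℕ, a + 1 + (b + 1) = 3 * k →
        (X 0 ^ (a + 2) * X 1 ^ (b + 3) : MvPolynomial (Fin 2) ℂ) ∈
          nodalCubicSystem ^ (k + 1) := by
      intro a b hab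
      rw [pow_succ]
      convert Submodule.mul_mem_mul (ih hab) h2 using 1
      ring
    rcases Nat.eq_zero_or_pos j with rfl | hj
    · obtain ⟨a, rfl⟩ : ∃ a, i = a + 4 := ⟨i - 4, by omega⟩
      have hM := Submodule.mul_mem_mul (ih (i := a + 1) (j := 0) (by omega)) h3
      rw [← pow_succ] at hM
      convert sub_mem hM (hB a 1 (by omega)) using 1
      ring
    rcases Nat.eq_zero_or_pos i with rfl | hi
    · obtain ⟨b, rfl⟩ : ∃ b, j = b + 4 := ⟨j - 4, by omega⟩
      have hM := Submodule.mul_mem_mul (ih (i := 0) (j := b + 1) (by omega)) h3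
      rw [← pow_succ] at hM
      convert sub_mem hM (hA 1 b (by omega)) using 1
      ring
    rcases Nat.lt_or_ge i 2 with hi2 | hi2
    · obtain ⟨b, rfl⟩ : ∃ b, j = b + 2 := ⟨j - 2, by omega⟩
      obtain rfl : i = 1 := by omega
      exact hB 0 b (by omega)
    · obtain ⟨a, rfl⟩ : ∃ a, i = a + 2 := ⟨i - 2, by omega⟩
      obtain ⟨b, rfl⟩ : ∃ b, j = b + 1 := ⟨j - 1, by omega⟩
      exact hA a b (by omega)

lemma X_pow_add_X_pow_mem_pow {k : ℕ} (hk : 0 < k) :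
    (X 0 ^ (3 * k) + X 1 ^ (3 * k) : MvPolynomial (Fin 2) ℂ) ∈ nodalCubicSystem ^ k := by
  have h3 : (X 0 ^ 3 + X 1 ^ 3 : MvPolynomial (Fin 2) ℂ) ∈ nodalCubicSystem :=
    Submodule.subset_span (by simp)
  induction k, hk using Nat.le_induction with
  | base => simpa using h3
  | succ k hk ih =>
    have hM := Submodule.mul_mem_mul ih h3
    rw [← pow_succ] at hM
    obtain ⟨m, hm⟩ : ∃ m, 3 * k = m + 1 := ⟨3 * k - 1, by omega⟩
    have h1 := X_pow_mul_X_pow_mem_pow (k := k + 1) (i := m) (j := 2) (by omega)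
    have h2 := X_pow_mul_X_pow_mem_pow (k := k + 1) (i := 2) (j := m) (by omega)
    convert sub_mem (sub_mem hM h1) h2 using 1
    rw [show 3 * (k + 1) = m + 4 by omega, hm]
    ring

lemma mem_pow_iff {k : ℕ} (hk : 0 < k) {f : MvPolynomial (Fin 2) ℂ} :
    f ∈ nodalCubicSystem ^ k ↔
      f.IsHomogeneous (3 * k) ∧ eval ![1, 0] f = eval ![0, 1] f := by
  refine ⟨fun h => ⟨isHomogeneous_of_mem_pow h, eval_eq_of_mem_pow h⟩, ?_⟩
  rintro ⟨hf, he⟩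
  let Φ : MvPolynomial (Fin 2) ℂ →ₗ[ℂ] MvPolynomial (Fin 2) ℂ :=
    LinearMap.id - (aeval ![(1 : ℂ), 0]).toLinearMap.smulRight (X 0 ^ (3 * k))
      - (aeval ![(0 : ℂ), 1]).toLinearMap.smulRight (X 1 ^ (3 * k))
  have hΦ : ∀ g, Φ g = g - eval ![1, 0] g • X 0 ^ (3 * k) - eval ![0, 1] g • X 1 ^ (3 * k) := by
    intro g
    simp [Φ, aeval_eq_eval]
  have hmem : Φ f ∈ nodalCubicSystem ^ k := by
    rw [f.as_sum, map_sum]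
    refine Submodule.sum_mem _ fun d hd => ?_
    have hdeg : d 0 + d 1 = 3 * k := by
      simpa [Finsupp.weight_apply, Finsupp.sum_fintype] using hf (mem_support_iff.1 hd)
    have hmon : monomial d (coeff d f) = coeff d f • (X 0 ^ d 0 * X 1 ^ d 1) := by
      rw [monomial_eq, smul_eq_C_mul, Finsupp.prod_fintype _ _ (by simp), Fin.prod_univ_two]
    rw [hmon, map_smul, hΦ]
    refine Submodule.smul_mem _ _ ?_
    rcases Nat.eq_zero_or_pos (d 0) with h0 | h0
    · have h1 : d 1 = 3 * k := by omega
      simp [h0, h1, hk.ne']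
    rcases Nat.eq_zero_or_pos (d 1) with h1 | h1
    · have h2 : d 0 = 3 * k := by omega
      simp [h1, h2, hk.ne']
    obtain ⟨i, hi⟩ : ∃ i, d 0 = i + 1 := ⟨d 0 - 1, by omega⟩
    obtain ⟨j, hj⟩ : ∃ j, d 1 = j + 1 := ⟨d 1 - 1, by omega⟩
    rw [hi, hj]
    simpa using X_pow_mul_X_pow_mem_pow (k := k) (i := i) (j := j) (by omega)
  rw [hΦ, ← he] at hmem
  convert add_mem hmem
    (Submodule.smul_mem _ (eval ![1, 0] f) (X_pow_add_X_pow_mem_pow hk)) using 1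
  rw [smul_add]
  ring

end Powers

section ValueSemigroup

/-- `(k, e)` is the value of a nonzero element of `L^k` at the point `(α : β)`. -/
def IsValue (α β : ℂ) (k e : ℕ) : Prop :=
  ∃ f : MvPolynomial (Fin 2) ℂ, f ∈ nodalCubicSystem ^ k ∧ f ≠ 0 ∧
    lform α β ^ e ∣ f ∧ ¬ lform α β ^ (e + 1) ∣ f

lemma curveValueSemigroup_eq_closure (α β : ℂ) :
    curveValueSemigroup nodalCubicSystem α β =
      AddSubmonoid.closure {p | ∃ k e : ℕ, IsValue α β k e ∧ p = ((k : ℤ), (e : ℤ))} := by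
  unfold curveValueSemigroup IsValue
  congr 1
  ext p
  constructor
  · rintro ⟨k, e, f, h1, h2, h3, h4, h5⟩
    exact ⟨k, e, ⟨f, h1, h2, h3, h4⟩, h5⟩
  · rintro ⟨k, e, ⟨f, h1, h2, h3, h4⟩, h5⟩
    exact ⟨k, e, f, h1, h2, h3, h4, h5⟩

variable {α β : ℂ}

lemma IsValue.le (h : (α, β) ≠ ((0 : ℂ), (0 : ℂ))) {k e : ℕ} (hv : IsValue α β k e) :
    e ≤ 3 * k := by
  obtain ⟨f, hf, hf0, hd, -⟩ := hv
  exact le_of_lform_pow_dvd h (isHomogeneous_of_mem_pow hf) hf0 hd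

lemma IsValue.lt (h : (α, β) ≠ ((0 : ℂ), (0 : ℂ))) {k e : ℕ}
    (hk : β ^ (3 * k) ≠ (-α) ^ (3 * k)) (hv : IsValue α β k e) : e < 3 * k := by
  refine lt_of_le_of_ne (hv.le h) ?_
  rintro rfl
  obtain ⟨f, hf, hf0, ⟨g, rfl⟩, -⟩ := hv
  have hg : g.IsHomogeneous 0 := by
    refine isHomogeneous_of_mul_left ((isHomogeneous_lform α β).pow (3 * k))
      (pow_ne_zero _ (lform_ne_zero h)) ?_
    simpa using isHomogeneous_of_mem_pow hf
  obtain ⟨c, rfl⟩ : ∃ c, g = C c :=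
    ⟨_, totalDegree_eq_zero_iff_eq_C.1 ((totalDegree_zero_iff_isHomogeneous _).2 hg)⟩
  have hc : c ≠ 0 := by
    rintro rfl
    simp at hf0
  have he := eval_eq_of_mem_pow hf
  simp only [map_mul, map_pow, eval_lform, eval_C] at he
  exact hk (by simpa using mul_right_cancel₀ hc he)

lemma isValue_of_eval_ne_zero (h : (α, β) ≠ ((0 : ℂ), (0 : ℂ))) {k e m : ℕ} (hk : 0 < k)
    (hkm : e + m = 3 * k) {g : MvPolynomial (Fin 2) ℂ} (hg : g.IsHomogeneous m)
    (he : β ^ e * eval ![1, 0] g = (-α) ^ e * eval ![0, 1] g)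
    (hQ : eval ![α, β] g ≠ 0) : IsValue α β k e := by
  refine ⟨lform α β ^ e * g, (mem_pow_iff hk).2 ⟨?_, ?_⟩, ?_, dvd_mul_right _ _,
    not_lform_pow_succ_dvd h hQ e⟩
  · have := ((isHomogeneous_lform α β).pow e).mul hg
    rwa [one_mul, hkm] at this
  · simpa [eval_lform] using he
  · refine mul_ne_zero (pow_ne_zero _ (lform_ne_zero h)) ?_
    rintro rfl
    simp at hQ

lemma isValue_three_mul_sub_one (h : (α, β) ≠ ((0 : ℂ), (0 : ℂ))) {k e : ℕ}
    (hk : β ^ (3 * k) ≠ (-α) ^ (3 * k)) (he : e + 1 = 3 * k) : IsValue α β k e := by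
  refine isValue_of_eval_ne_zero h (m := 1) (by omega) he
    (g := C ((-α) ^ e) * X 0 + C (β ^ e) * X 1)
    ((isHomogeneous_C_mul_X _ 0).add (isHomogeneous_C_mul_X _ 1)) ?_ ?_
  · simp [mul_comm]
  · simp only [map_add, map_mul, eval_C, eval_X, Matrix.cons_val_zero, Matrix.cons_val_one]
    rw [← he] at hk
    contrapose! hk
    linear_combination hk

lemma isValue_of_add_two_le (hα : α ≠ 0) (hβ : β ≠ 0) {k e : ℕ} (hke : e + 2 ≤ 3 * k) :
    IsValue α β k e := by
  obtain ⟨m, hm⟩ := Nat.exists_eq_add_of_le hke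
  refine isValue_of_eval_ne_zero (by simp [hα]) (m := 1 + (m + 1)) (by omega) (by omega)
    (g := X 0 * X 1 ^ (m + 1)) ((isHomogeneous_X ℂ 0).mul (isHomogeneous_X_pow 1 (m + 1))) ?_ ?_
  · simp
  · simp [hα, hβ]

lemma isValue_three_mul (h : (α, β) ≠ ((0 : ℂ), (0 : ℂ))) {k : ℕ} (hk : 0 < k)
    (hr : β ^ (3 * k) = (-α) ^ (3 * k)) : IsValue α β k (3 * k) :=
  isValue_of_eval_ne_zero h (m := 0) hk (by omega) (g := 1) (isHomogeneous_one _ _)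
    (by simpa using hr) (by simp)

lemma IsValue.of_add (hα : α ≠ 0) {r k e : ℕ} (hk : 0 < k)
    (hr : β ^ (3 * r) = (-α) ^ (3 * r)) (hv : IsValue α β (k + r) (e + 3 * r)) :
    IsValue α β k e := by
  have h : (α, β) ≠ ((0 : ℂ), (0 : ℂ)) := by simp [hα]
  obtain ⟨f, hf, hf0, ⟨g, rfl⟩, hd⟩ := hv
  have hl : lform α β ^ (3 * r) ≠ 0 := pow_ne_zero _ (lform_ne_zero h)
  have heq : lform α β ^ (e + 3 * r) * g = lform α β ^ (3 * r) * (lform α β ^ e * g) := by ring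
  rw [heq] at hf hf0 hd
  rw [show e + 3 * r + 1 = 3 * r + (e + 1) by ring, pow_add, mul_dvd_mul_iff_left hl] at hd
  refine ⟨_, (mem_pow_iff hk).2 ⟨?_, ?_⟩, right_ne_zero_of_mul hf0, dvd_mul_right _ _, hd⟩
  · refine isHomogeneous_of_mul_left ((isHomogeneous_lform α β).pow (3 * r)) hl ?_
    have := isHomogeneous_of_mem_pow hf
    rwa [show 3 * (k + r) = 1 * (3 * r) + 3 * k by ring] at this
  · have he := eval_eq_of_mem_pow hf
    rw [map_mul, map_mul _ (lform α β ^ (3 * r))] at he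
    simp only [map_pow _ (lform α β) (3 * r), eval_lform, mul_one, mul_zero, sub_zero, zero_sub,
      hr] at he
    exact mul_left_cancel₀ (pow_ne_zero _ (neg_ne_zero.2 hα)) he

theorem not_fg_of_forall_ne (h : (α, β) ≠ ((0 : ℂ), (0 : ℂ)))
    (hne : ∀ k : ℕ, 0 < k → β ^ (3 * k) ≠ (-α) ^ (3 * k)) :
    ¬ (curveValueSemigroup nodalCubicSystem α β).FG := by
  rw [curveValueSemigroup_eq_closure]
  set G : Set (ℤ × ℤ) := {p | ∃ k e : ℕ, IsValue α β k e ∧ p = ((k : ℤ), (e : ℤ))}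
  rintro ⟨T, hT⟩
  have hS : ∀ p ∈ AddSubmonoid.closure G, p = 0 ∨ p.2 < 3 * p.1 := by
    intro p hp
    induction hp using AddSubmonoid.closure_induction with
    | mem x hx =>
      obtain ⟨k, e, hv, rfl⟩ := hx
      rcases Nat.eq_zero_or_pos k with rfl | hk
      · have := hv.le h
        left
        exact Prod.ext rfl (by simpa using this)
      · have := hv.lt h (hne k hk)
        right
        simp only
        omega
    | zero => exact Or.inl rfl
    | add x y _ _ hx hy =>
      rcases hx with rfl | hx
      · simpa using hy
      rcases hy with rfl | hy
      · simpa using Or.inr hx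
      right
      simp only [Prod.fst_add, Prod.snd_add]
      omega
  obtain ⟨M, hM⟩ : ∃ M : ℕ, ∀ p ∈ T, p.1 ≤ M := by
    obtain ⟨b, hb⟩ := (T.image Prod.fst).bddAbove
    refine ⟨b.toNat, fun p hp => ?_⟩
    have : p.1 ≤ b := hb (by simpa using ⟨p.2, hp⟩)
    omega
  have hslope : ∀ p ∈ AddSubmonoid.closure (T : Set (ℤ × ℤ)), p.1 ≤ M * (3 * p.1 - p.2) := by
    intro p hp
    induction hp using AddSubmonoid.closure_induction with
    | mem x hx =>
      rcases hS x (hT ▸ AddSubmonoid.subset_closure hx) with rfl | hlt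
      · simp
      · have := hM x hx
        nlinarith
    | zero => simp
    | add x y _ _ hx hy =>
      simp only [Prod.fst_add, Prod.snd_add]
      linarith
  have hv : IsValue α β (M + 1) (3 * M + 2) :=
    isValue_three_mul_sub_one h (hne _ (by omega)) (by omega)
  have hmem : (((M + 1 : ℕ) : ℤ), ((3 * M + 2 : ℕ) : ℤ)) ∈
      AddSubmonoid.closure (T : Set (ℤ × ℤ)) :=
    hT ▸ AddSubmonoid.subset_closure ⟨_, _, hv, rfl⟩
  replace hmem := hslope _ hmem
  push_cast at hmem
  linarith

theorem fg_of_pow_eq (h : (α, β) ≠ ((0 : ℂ), (0 : ℂ))) {r : ℕ} (hr0 : 0 < r)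
    (hr : β ^ (3 * r) = (-α) ^ (3 * r)) :
    (curveValueSemigroup nodalCubicSystem α β).FG := by
  have hα : α ≠ 0 := by
    rintro rfl
    exact h (by simpa [hr0.ne'] using hr)
  have hβ : β ≠ 0 := by
    rintro rfl
    have h3 : 3 * r ≠ 0 := by omega
    rw [zero_pow h3] at hr
    exact pow_ne_zero _ (neg_ne_zero.2 hα) hr.symm
  rw [curveValueSemigroup_eq_closure, AddSubmonoid.fg_iff]
  set T : Set (ℤ × ℤ) :=
    {p | ∃ k e : ℕ, IsValue α β k e ∧ k ≤ r + 1 ∧ p = ((k : ℤ), (e : ℤ))}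
  refine ⟨T, le_antisymm (AddSubmonoid.closure_mono ?_) (AddSubmonoid.closure_le.2 ?_), ?_⟩
  · rintro p ⟨k, e, hv, -, rfl⟩
    exact ⟨k, e, hv, rfl⟩
  · rintro p ⟨k, e, hv, rfl⟩
    induction k using Nat.strong_induction_on generalizing e with
    | _ k ih =>
      rcases Nat.lt_or_ge (r + 1) k with hk | hk
      · rcases Nat.lt_or_ge e (3 * r) with he | he
        · obtain ⟨n, rfl⟩ : ∃ n, k = n + 1 := ⟨k - 1, by omega⟩
          have h1 : (((1 : ℕ) : ℤ), ((0 : ℕ) : ℤ)) ∈ T :=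
            ⟨1, 0, isValue_of_add_two_le hα hβ (by omega), by omega, rfl⟩
          have h2 := ih n (by omega) e (isValue_of_add_two_le hα hβ (by omega))
          convert add_mem h2 (AddSubmonoid.subset_closure h1) using 1
          simp
        · obtain ⟨n, rfl⟩ : ∃ n, k = n + r := ⟨k - r, by omega⟩
          obtain ⟨c, rfl⟩ : ∃ c, e = c + 3 * r := ⟨e - 3 * r, by omega⟩
          have h1 : (((r : ℕ) : ℤ), ((3 * r : ℕ) : ℤ)) ∈ T :=
            ⟨r, 3 * r, isValue_three_mul h hr0 hr, by omega, rfl⟩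
          have h2 := ih n (by omega) c (hv.of_add hα (by omega) hr)
          convert add_mem h2 (AddSubmonoid.subset_closure h1) using 1
          simp
      · exact AddSubmonoid.subset_closure ⟨k, e, hv, hk, rfl⟩
  · refine (Set.finite_Icc ((0 : ℤ), (0 : ℤ)) ((r : ℤ) + 1, 3 * ((r : ℤ) + 1))).subset ?_
    rintro p ⟨k, e, hv, hk, rfl⟩
    have := hv.le h
    refine ⟨⟨?_, ?_⟩, ⟨?_, ?_⟩⟩ <;> simp only <;> omega

theorem fg_iff_exists_pow_eq (h : (α, β) ≠ ((0 : ℂ), (0 : ℂ))) :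
    (curveValueSemigroup nodalCubicSystem α β).FG ↔
      ∃ k : ℕ, 0 < k ∧ β ^ (3 * k) = (-α) ^ (3 * k) := by
  refine ⟨fun hfg => ?_, fun ⟨k, hk, hr⟩ => fg_of_pow_eq h hk hr⟩
  by_contra! hne
  exact not_fg_of_forall_ne h hne hfg

lemma exists_pow_eq_neg_pow_iff (h : (α, β) ≠ ((0 : ℂ), (0 : ℂ))) :
    (∃ k : ℕ, 0 < k ∧ β ^ (3 * k) = (-α) ^ (3 * k)) ↔
      α ≠ 0 ∧ ∃ n : ℕ, 0 < n ∧ (β / α) ^ n = 1 := by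
  constructor
  · rintro ⟨k, hk, hr⟩
    have hα : α ≠ 0 := by
      rintro rfl
      exact h (by simpa [hk.ne'] using hr)
    refine ⟨hα, 3 * k * 2, by omega, ?_⟩
    rw [div_pow, pow_mul β, hr, ← pow_mul, Even.neg_pow ⟨3 * k, by ring⟩]
    exact div_self (pow_ne_zero _ hα)
  · rintro ⟨hα, n, hn, hr⟩
    refine ⟨2 * n, by omega, ?_⟩
    rw [div_pow, div_eq_one_iff_eq (pow_ne_zero _ hα)] at hr
    rw [Even.neg_pow ⟨3 * n, by ring⟩, show 3 * (2 * n) = n * 6 by ring, pow_mul, hr, ← pow_mul]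

end ValueSemigroup

/-- **Example 4.13.** Over `K = ℂ`, let `L ⊆ Sym³` be the span of `{s²·t, s·t², s³ + t³}`.
For a point `Q = (α : β)` of `ℙ¹`, the value semigroup `S(L, Q)` is finitely generated iff
`α ≠ 0` and `β/α` is a root of unity, equivalently iff `β^{3k} = (−α)^{3k}` for some `k > 0`.
In particular `S(L, Q)` fails to be finitely generated for some `Q`, yet there are
infinitely many `Q` for which it is finitely generated. -/
theorem example413_khovanskiiFinite_iff_rootOfUnity :
    (∀ α β : ℂ, (α, β) ≠ ((0 : ℂ), (0 : ℂ)) →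
      ((curveValueSemigroup
          (Submodule.span ℂ
            ({X 0 ^ 2 * X 1, X 0 * X 1 ^ 2, X 0 ^ 3 + X 1 ^ 3} : Set (MvPolynomial (Fin 2) ℂ)))
          α β).FG ↔ (α ≠ 0 ∧ ∃ n : ℕ, 0 < n ∧ (β / α) ^ n = 1))) ∧
    (∀ α β : ℂ, (α, β) ≠ ((0 : ℂ), (0 : ℂ)) →
      ((curveValueSemigroup
          (Submodule.span ℂ
            ({X 0 ^ 2 * X 1, X 0 * X 1 ^ 2, X 0 ^ 3 + X 1 ^ 3} : Set (MvPolynomial (Fin 2) ℂ)))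
          α β).FG ↔ ∃ k : ℕ, 0 < k ∧ β ^ (3 * k) = (-α) ^ (3 * k))) ∧
    (∃ α β : ℂ, (α, β) ≠ ((0 : ℂ), (0 : ℂ)) ∧
      ¬ (curveValueSemigroup
          (Submodule.span ℂ
            ({X 0 ^ 2 * X 1, X 0 * X 1 ^ 2, X 0 ^ 3 + X 1 ^ 3} : Set (MvPolynomial (Fin 2) ℂ)))
          α β).FG) ∧
    {q : ℂ × ℂ | q ≠ (0, 0) ∧
      (curveValueSemigroup
          (Submodule.span ℂ
            ({X 0 ^ 2 * X 1, X 0 * X 1 ^ 2, X 0 ^ 3 + X 1 ^ 3} : Set (MvPolynomial (Fin 2) ℂ)))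
          q.1 q.2).FG}.Infinite := by
  refine ⟨fun α β h => (fg_iff_exists_pow_eq h).trans (exists_pow_eq_neg_pow_iff h),
    fun α β h => fg_iff_exists_pow_eq h, ⟨0, 1, by simp, ?_⟩, ?_⟩
  · refine not_fg_of_forall_ne (by simp) fun k hk => ?_
    simp [hk.ne']
  · have hinj : Function.Injective fun n : ℕ => ((n : ℂ) + 1, (n : ℂ) + 1) := by
      intro a b hab
      simpa using hab
    refine (Set.infinite_range_of_injective hinj).mono ?_
    rintro _ ⟨n, rfl⟩
    have hn : (n : ℂ) + 1 ≠ 0 := Nat.cast_add_one_ne_zero n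
    refine ⟨by simp [hn], fg_of_pow_eq (r := 2) (by simp [hn]) two_pos ?_⟩
    rw [Even.neg_pow ⟨3, rfl⟩]

end
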